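/- If ||π − π*||_∞ ≤ min_k π*_k/(2K), then for every h > 0, sup_{ψ ∈ Ψ_K(X)} |L^(h)(π*,ψ) − L^(h)(π,ψ)| ≤ 2 Σ_{k=1}^K |π_k − π*_k|/π*_k; in particular there is a constant C > 0 (depending only on π*) such that sup_{ψ ∈ Ψ_K(X)} |L^(h)(π*,ψ) − L^(h)(π,ψ)| ≤ C ||π − π*||_1. -/

import Mathlib

open MeasureTheory Filter Topology

noncomputable section

/-- Rescaled kernel `K_h(u) = K(u/h)/h`. -/
def Kh (Kker : ℝ → ℝ) (h u : ℝ) : ℝ := Kker (u / h) / h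

/-- Nonlinear smoothing operator `N_j^{(h)}ψ(u) = exp((K_h ⋆ ln ψ)(u))`,
the convolution being taken over the domain `Xj`. -/
def Nsm (Kker : ℝ → ℝ) (h : ℝ) (Xj : Set ℝ) (ψ : ℝ → ℝ) (u : ℝ) : ℝ :=
  Real.exp (∫ v in Xj, Kh Kker h (u - v) * Real.log (ψ v))

/-- The class `Ψ(X_j)` of admissible univariate component densities on `Xj`:
densities that are positive, bounded by `C1`, with `‖ln ψ‖_{L²} ≤ C2` and
`‖(ln ψ)''‖_{L^∞} ≤ C3`. -/
def PsiClass (C1 C2 C3 : ℝ) (Xj : Set ℝ) : Set (ℝ → ℝ) :=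
  {ψ | (∀ x ∈ Xj, 0 < ψ x) ∧ (∀ x ∈ Xj, ψ x ≤ C1) ∧
    (∫ x in Xj, ψ x) = 1 ∧
    (∫ x in Xj, (Real.log (ψ x)) ^ 2) ≤ C2 ^ 2 ∧
    (∀ x ∈ Xj, |deriv (deriv (fun t => Real.log (ψ t))) x| ≤ C3)}

/-- Mixture density `g_{π,ψ}(x) = Σ_k π_k ∏_j ψ_{k,j}(x_j)`. -/
def mix {J K : ℕ} (π : Fin K → ℝ) (ψ : Fin K → Fin J → ℝ → ℝ) (x : Fin J → ℝ) : ℝ :=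
  ∑ k, π k * ∏ j, ψ k j (x j)

/-- Smoothed mixture subdensity `f^{(h)}_{π,ψ}`. -/
def smix {J K : ℕ} (Kker : ℝ → ℝ) (h : ℝ) (Xs : Fin J → Set ℝ)
    (π : Fin K → ℝ) (ψ : Fin K → Fin J → ℝ → ℝ) (x : Fin J → ℝ) : ℝ :=
  ∑ k, π k * ∏ j, Nsm Kker h (Xs j) (ψ k j) (x j)

/-- Membership in the simplex `S_K`. -/
def memSimplex {K : ℕ} (π : Fin K → ℝ) : Prop :=
  (∀ k, 0 ≤ π k) ∧ (∑ k, π k) = 1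

/-- Membership in the restricted (ordered) simplex `S_K^r`. -/
def memSimplexOrd {K : ℕ} (π : Fin K → ℝ) : Prop :=
  memSimplex π ∧ Monotone π

/-- Membership in `Ψ_K(X)`. -/
def memPsiK {J K : ℕ} (C1 C2 C3 : ℝ) (Xs : Fin J → Set ℝ)
    (ψ : Fin K → Fin J → ℝ → ℝ) : Prop :=
  ∀ k j, ψ k j ∈ PsiClass C1 C2 C3 (Xs j)

/-- Membership in `Θ_K = S_K^r × Ψ_K(X)`. -/
def memTheta {J K : ℕ} (C1 C2 C3 : ℝ) (Xs : Fin J → Set ℝ)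
    (π : Fin K → ℝ) (ψ : Fin K → Fin J → ℝ → ℝ) : Prop :=
  memSimplexOrd π ∧ memPsiK C1 C2 C3 Xs ψ

/-- Smoothed population loss `L^{(h)}(π,ψ) = ∫ g* ln (g*/f^{(h)}_{π,ψ})`. -/
def Lh {J K : ℕ} (Kker : ℝ → ℝ) (h : ℝ) (Xs : Fin J → Set ℝ)
    (gstar : (Fin J → ℝ) → ℝ)
    (π : Fin K → ℝ) (ψ : Fin K → Fin J → ℝ → ℝ) : ℝ :=
  ∫ x in Set.univ.pi Xs, gstar x * Real.log (gstar x / smix Kker h Xs π ψ x)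

/-- Unsmoothed population loss `L^{(0)}(π,ψ) = ∫ g* ln (g*/g_{π,ψ})`. -/
def L0 {J K : ℕ} (Xs : Fin J → Set ℝ) (gstar : (Fin J → ℝ) → ℝ)
    (π : Fin K → ℝ) (ψ : Fin K → Fin J → ℝ → ℝ) : ℝ :=
  ∫ x in Set.univ.pi Xs, gstar x * Real.log (gstar x / mix π ψ x)

/-- Empirical smoothed loss `L^{(h,n)}(π,ψ) = n⁻¹ Σ_i ln (g*(X_i)/f^{(h)}_{π,ψ}(X_i))`. -/
def Lhn {Ω : Type*} {J K : ℕ} (Kker : ℝ → ℝ) (h : ℝ) (Xs : Fin J → Set ℝ)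
    (gstar : (Fin J → ℝ) → ℝ) (Xi : ℕ → Ω → (Fin J → ℝ))
    (π : Fin K → ℝ) (ψ : Fin K → Fin J → ℝ → ℝ) (n : ℕ) (ω : Ω) : ℝ :=
  (n : ℝ)⁻¹ * ∑ i ∈ Finset.range n,
    Real.log (gstar (Xi i ω) / smix Kker h Xs π ψ (Xi i ω))

/-- Smoothed posterior membership weights `ω^{(h)}_{π,ψ,k}`. -/
def omegaW {J K : ℕ} (Kker : ℝ → ℝ) (h : ℝ) (Xs : Fin J → Set ℝ)
    (π : Fin K → ℝ) (ψ : Fin K → Fin J → ℝ → ℝ) (k : Fin K) (x : Fin J → ℝ) : ℝ :=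
  π k * (∏ j, Nsm Kker h (Xs j) (ψ k j) (x j)) / smix Kker h Xs π ψ x

/-- Population MM map `M^{(h,π)}_{k,j}[ψ]`. -/
def MMapPop {J K : ℕ} (Kker : ℝ → ℝ) (h : ℝ) (Xs : Fin J → Set ℝ)
    (gstar : (Fin J → ℝ) → ℝ) (π : Fin K → ℝ) (ψ : Fin K → Fin J → ℝ → ℝ)
    (k : Fin K) (j : Fin J) (u : ℝ) : ℝ :=
  (π k)⁻¹ * ∫ x in Set.univ.pi Xs,
    gstar x * omegaW Kker h Xs π ψ k x * Kh Kker h (x j - u)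

/-- Empirical MM map `M^{(h,n,π)}_{k,j}[ψ]`. -/
def MMapEmp {Ω : Type*} {J K : ℕ} (Kker : ℝ → ℝ) (h : ℝ) (Xs : Fin J → Set ℝ)
    (Xi : ℕ → Ω → (Fin J → ℝ)) (π : Fin K → ℝ) (ψ : Fin K → Fin J → ℝ → ℝ)
    (n : ℕ) (ω : Ω) (k : Fin K) (j : Fin J) (u : ℝ) : ℝ :=
  ((n : ℝ) * π k)⁻¹ * ∑ i ∈ Finset.range n,
    omegaW Kker h Xs π ψ k (Xi i ω) * Kh Kker h (Xi i ω j - u)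

/-- `L¹`-distance of two functions over a domain. -/
def L1dist (Xj : Set ℝ) (f g : ℝ → ℝ) : ℝ := ∫ u in Xj, |f u - g u|

/-- Empirical process `𝔾_n s = n^{-1/2} Σ_i (s(X_i) - E_{g*}[s(X)])`. -/
def Gn {Ω : Type*} {J : ℕ} (Xs : Fin J → Set ℝ) (gstar : (Fin J → ℝ) → ℝ)
    (Xi : ℕ → Ω → (Fin J → ℝ)) (s : (Fin J → ℝ) → ℝ) (n : ℕ) (ω : Ω) : ℝ :=
  ((n : ℝ) ^ (-(1:ℝ)/2)) * ∑ i ∈ Finset.range n,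
    (s (Xi i ω) - ∫ x in Set.univ.pi Xs, s x * gstar x)

/-- Empirical mean `P_n s = n⁻¹ Σ_i s(X_i)`. -/
def Pn {Ω : Type*} {J : ℕ} (Xi : ℕ → Ω → (Fin J → ℝ)) (s : (Fin J → ℝ) → ℝ)
    (n : ℕ) (ω : Ω) : ℝ :=
  (n : ℝ)⁻¹ * ∑ i ∈ Finset.range n, s (Xi i ω)

/-- Kernel regularity assumptions (Assumptions 2 of the paper): a symmetric,
continuous, square-integrable density of order 2 whose derivative is
square-integrable, bounded above and away from zero after rescaling, Lipschitz
after rescaling, and Gaussian or sub-Gaussian. -/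
structure KernelHyp (Kker : ℝ → ℝ) : Prop where
  nonneg : ∀ u, 0 ≤ Kker u
  integral_one : (∫ u, Kker u) = 1
  symm : ∀ u, Kker (-u) = Kker u
  cont : Continuous Kker
  sqInt : Integrable fun u => (Kker u) ^ 2
  mom1 : (∫ u, u * Kker u) = 0
  mom2 : (∫ u, u ^ 2 * Kker u) ≠ 0
  derivSqInt : Integrable fun u => (deriv Kker u) ^ 2
  bounds : ∀ h : ℝ, 0 < h → ∃ b1 b2 : ℝ, 0 < b1 ∧
    ∀ u v : ℝ, b1 ≤ Kh Kker h (u - v) ∧ Kh Kker h (u - v) ≤ b2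
  lipschitz : ∀ h : ℝ, 0 < h → ∃ L : ℝ, 0 < L ∧
    ∀ x y : ℝ, |Kh Kker h x - Kh Kker h y| ≤ L * |x - y|
  subGaussian : ∃ a b : ℝ, 0 < a ∧ 0 < b ∧ ∀ u, Kker u ≤ a * Real.exp (-(b * u ^ 2))

/-- The law of the observations: the measure with density `g*` on `X`. -/
def lawStar {J : ℕ} (Xs : Fin J → Set ℝ) (gstar : (Fin J → ℝ) → ℝ) :
    Measure (Fin J → ℝ) :=
  (volume.restrict (Set.univ.pi Xs)).withDensity fun x => ENNReal.ofReal (gstar x)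

/-- Identifiability assumptions (Assumptions 1 of the paper): positive,
pairwise-distinct mixture proportions, and linear independence of the
component densities for at least three coordinates. -/
def IdentAssump {J K : ℕ} (Xs : Fin J → Set ℝ) (πstar : Fin K → ℝ)
    (ψstar : Fin K → Fin J → ℝ → ℝ) : Prop :=
  (∀ k, 0 < πstar k) ∧
  (∃ S : Finset (Fin J), 3 ≤ S.card ∧
    ∀ j ∈ S, LinearIndependent ℝ fun k : Fin K => (Xs j).restrict (ψstar k j)) ∧
  (∀ k l, k ≠ l → πstar k ≠ πstar l)

lemma aux_ratio {K : ℕ} (a b N : Fin K → ℝ) (ha : ∀ k, 0 < a k) (hN : ∀ k, 0 < N k)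
    (hK : 1 ≤ K) :
    0 < ∑ k, a k * N k ∧
    (∑ k, b k * N k - ∑ k, a k * N k) / (∑ k, a k * N k) ≤ ∑ k, |b k - a k| / a k := by
  have hne : Nonempty (Fin K) := ⟨⟨0, hK⟩⟩
  have hpos : 0 < ∑ k, a k * N k :=
    Finset.sum_pos (fun k _ => mul_pos (ha k) (hN k)) Finset.univ_nonempty
  refine ⟨hpos, ?_⟩
  rw [div_le_iff₀ hpos, ← Finset.sum_sub_distrib, Finset.sum_mul]
  refine Finset.sum_le_sum fun k _ => ?_
  have h1 : a k * N k ≤ ∑ k, a k * N k :=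
    Finset.single_le_sum (f := fun k => a k * N k)
      (fun i _ => (mul_pos (ha i) (hN i)).le) (Finset.mem_univ k)
  calc b k * N k - a k * N k = (b k - a k) * N k := by ring
    _ ≤ |b k - a k| * N k := mul_le_mul_of_nonneg_right (le_abs_self _) (hN k).le
    _ = |b k - a k| / a k * (a k * N k) := by
        have := (ha k).ne'
        field_simp
    _ ≤ _ := mul_le_mul_of_nonneg_left h1 (div_nonneg (abs_nonneg _) (ha k).le)

lemma aux_log {K : ℕ} (a b N : Fin K → ℝ) (ha : ∀ k, 0 < a k) (hb : ∀ k, a k / 2 ≤ b k)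
    (hN : ∀ k, 0 < N k) (hK : 1 ≤ K) :
    |Real.log (∑ k, b k * N k) - Real.log (∑ k, a k * N k)| ≤ 2 * ∑ k, |b k - a k| / a k := by
  have hb0 : ∀ k, 0 < b k := fun k => by linarith [ha k, hb k]
  obtain ⟨p1, q1⟩ := aux_ratio a b N ha hN hK
  obtain ⟨p2, q2⟩ := aux_ratio b a N hb0 hN hK
  have h0 : 0 ≤ ∑ k, |b k - a k| / a k :=
    Finset.sum_nonneg fun k _ => div_nonneg (abs_nonneg _) (ha k).le
  have h2 : ∑ k, |a k - b k| / b k ≤ 2 * ∑ k, |b k - a k| / a k := by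
    rw [Finset.mul_sum]
    refine Finset.sum_le_sum fun k _ => ?_
    rw [abs_sub_comm, ← mul_div_assoc, div_le_div_iff₀ (hb0 k) (ha k)]
    nlinarith [abs_nonneg (b k - a k), hb k]
  have l1 := Real.log_le_sub_one_of_pos (div_pos p2 p1)
  have l2 := Real.log_le_sub_one_of_pos (div_pos p1 p2)
  rw [Real.log_div p2.ne' p1.ne'] at l1
  rw [Real.log_div p1.ne' p2.ne'] at l2
  rw [sub_div, div_self p1.ne'] at q1
  rw [sub_div, div_self p2.ne'] at q2
  rw [abs_le]
  constructor <;> linarith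

lemma aux_Nsm_meas (Kker : ℝ → ℝ) (hKc : Continuous Kker) (h : ℝ) (Xj : Set ℝ) (ψ : ℝ → ℝ)
    (hψ : AEStronglyMeasurable ψ (volume.restrict Xj)) : Measurable (Nsm Kker h Xj ψ) := by
  obtain ⟨φ, hφ, he⟩ := hψ
  have : Nsm Kker h Xj ψ = fun u => Real.exp
      (∫ v in Xj, Kh Kker h (u - v) * Real.log (φ v)) := by
    funext u
    unfold Nsm
    congr 1
    apply integral_congr_ae
    filter_upwards [he] with v hv
    rw [hv]
  rw [this]
  apply Real.measurable_exp.comp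
  have hm : Measurable (fun p : ℝ × ℝ => Kh Kker h (p.1 - p.2) * Real.log (φ p.2)) := by
    have h1 : Measurable Kker := hKc.measurable
    have h2 : Measurable φ := hφ.measurable
    unfold Kh
    fun_prop
  exact (hm.stronglyMeasurable.integral_prod_right (ν := volume.restrict Xj)).measurable

lemma aux_psi_int {C1 C2 C3 : ℝ} {Xj : Set ℝ} {ψ : ℝ → ℝ} (h : ψ ∈ PsiClass C1 C2 C3 Xj) :
    Integrable ψ (volume.restrict Xj) := by
  by_contra hc
  have := h.2.2.1
  rw [integral_undef hc] at this
  exact zero_ne_one this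

lemma aux_mix {J K : ℕ} {C1 C2 C3 : ℝ} {Xs : Fin J → Set ℝ} {π : Fin K → ℝ}
    {ψ : Fin K → Fin J → ℝ → ℝ} (hψ : memPsiK C1 C2 C3 Xs ψ) (hπ : ∑ k, π k = 1) :
    Integrable (mix π ψ) (volume.restrict (Set.univ.pi Xs)) ∧
    ∫ x in Set.univ.pi Xs, mix π ψ x = 1 := by
  have hr : (volume : Measure (Fin J → ℝ)).restrict (Set.univ.pi Xs)
      = Measure.pi (fun j => volume.restrict (Xs j)) := by
    rw [volume_pi, Measure.restrict_pi_pi]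
  rw [hr]
  have hi : ∀ k, Integrable (fun x : Fin J → ℝ => ∏ j, ψ k j (x j))
      (Measure.pi (fun j => volume.restrict (Xs j))) := fun k =>
    Integrable.fintype_prod (f := fun j => ψ k j) fun j => aux_psi_int (hψ k j)
  have hi' := fun k => (hi k).const_mul (π k)
  unfold mix
  refine ⟨integrable_finsetSum _ fun k _ => hi' k, ?_⟩
  rw [integral_finsetSum _ fun k _ => hi' k, ← hπ]
  refine Finset.sum_congr rfl fun k _ => ?_
  rw [integral_const_mul, integral_fintype_prod_eq_prod (f := fun j => ψ k j)]
  rw [Finset.prod_eq_one fun j _ => (hψ k j).2.2.1, mul_one]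

lemma aux_main
    (J K : ℕ) (hK : 1 ≤ K)
    (Xs : Fin J → Set ℝ) (hXc : ∀ j, IsCompact (Xs j))
    (C1 C2 C3 : ℝ)
    (Kker : ℝ → ℝ)
    (hKcont : Continuous Kker)
    (πstar : Fin K → ℝ) (ψstar : Fin K → Fin J → ℝ → ℝ)
    (hstar : memTheta C1 C2 C3 Xs πstar ψstar)
    (hπpos : ∀ k, 0 < πstar k) (π : Fin K → ℝ)
    (hclose : ∀ k, |π k - πstar k| ≤ (⨅ k, πstar k) / (2 * K))
    (h : ℝ) (ψ : Fin K → Fin J → ℝ → ℝ) (hψ : memPsiK C1 C2 C3 Xs ψ) :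
    |Lh Kker h Xs (mix πstar ψstar) πstar ψ -
      Lh Kker h Xs (mix πstar ψstar) π ψ| ≤ 2 * ∑ k, |π k - πstar k| / πstar k := by
  have hne : Nonempty (Fin K) := ⟨⟨0, hK⟩⟩
  have hKr : (1:ℝ) ≤ K := by exact_mod_cast hK
  have hhalf : ∀ k, πstar k / 2 ≤ π k := by
    intro k
    have h1 : (⨅ k, πstar k) ≤ πstar k := ciInf_le (Set.finite_range _).bddBelow k
    have h2 : (⨅ k, πstar k) / (2 * K) ≤ πstar k / 2 := by
      rw [div_le_div_iff₀ (by linarith) (by norm_num)]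
      nlinarith [hπpos k]
    have h3 := (abs_le.mp (hclose k)).1
    linarith
  have hπ0 : ∀ k, 0 < π k := fun k => by linarith [hπpos k, hhalf k]
  set c := 2 * ∑ k, |π k - πstar k| / πstar k with hc
  set g := mix πstar ψstar with hg
  obtain ⟨gint, gone⟩ := aux_mix hstar.2 hstar.1.1.2
  rw [← hg] at gint gone
  set D : (Fin J → ℝ) → ℝ := fun x =>
    Real.log (smix Kker h Xs π ψ x) - Real.log (smix Kker h Xs πstar ψ x) with hD
  have hNpos : ∀ (x : Fin J → ℝ) k, 0 < ∏ j, Nsm Kker h (Xs j) (ψ k j) (x j) :=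
    fun x k => Finset.prod_pos fun j _ => Real.exp_pos _
  have hDb : ∀ x, |D x| ≤ c := fun x => aux_log πstar π
    (fun k => ∏ j, Nsm Kker h (Xs j) (ψ k j) (x j)) hπpos hhalf (hNpos x) hK
  have hsm : ∀ p : Fin K → ℝ, Measurable (smix Kker h Xs p ψ) := by
    intro p
    unfold smix
    refine Finset.measurable_fun_sum _ fun k _ => Measurable.const_mul
      (Finset.measurable_fun_prod _ fun j _ => ?_) _
    exact (aux_Nsm_meas Kker hKcont h (Xs j) (ψ k j)
      (aux_psi_int (hψ k j)).aestronglyMeasurable).comp (measurable_pi_apply j)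
  have hDm : Measurable D := (hsm π).log.sub (hsm πstar).log
  have hgD : Integrable (fun x => g x * D x) (volume.restrict (Set.univ.pi Xs)) :=
    gint.mul_bdd (c := c) hDm.aestronglyMeasurable
      (Eventually.of_forall fun x => by rw [Real.norm_eq_abs]; exact hDb x)
  have hXm : MeasurableSet (Set.univ.pi Xs) :=
    MeasurableSet.univ_pi fun j => (hXc j).isClosed.measurableSet
  have gpos : ∀ x ∈ Set.univ.pi Xs, 0 < g x := fun x hx =>
    Finset.sum_pos (fun k _ => mul_pos (hπpos k)
      (Finset.prod_pos fun j _ => (hstar.2 k j).1 _ (hx j trivial))) Finset.univ_nonempty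
  have hs1 : ∀ x, 0 < smix Kker h Xs π ψ x := fun x =>
    Finset.sum_pos (fun k _ => mul_pos (hπ0 k) (hNpos x k)) Finset.univ_nonempty
  have hs2 : ∀ x, 0 < smix Kker h Xs πstar ψ x := fun x =>
    Finset.sum_pos (fun k _ => mul_pos (hπpos k) (hNpos x k)) Finset.univ_nonempty
  have hAB : (fun x => g x * Real.log (g x / smix Kker h Xs πstar ψ x)) =ᵐ[
      volume.restrict (Set.univ.pi Xs)]
      fun x => g x * Real.log (g x / smix Kker h Xs π ψ x) + g x * D x := by
    filter_upwards [ae_restrict_mem hXm] with x hx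
    rw [Real.log_div (gpos x hx).ne' (hs1 x).ne', Real.log_div (gpos x hx).ne' (hs2 x).ne', hD]
    ring
  have c0 : 0 ≤ c := (abs_nonneg _).trans (hDb 0)
  unfold Lh
  rw [integral_congr_ae hAB]
  by_cases hB : Integrable (fun x => g x * Real.log (g x / smix Kker h Xs π ψ x))
      (volume.restrict (Set.univ.pi Xs))
  · rw [integral_add hB hgD, add_sub_cancel_left, ← Real.norm_eq_abs]
    calc _ ≤ ∫ x in Set.univ.pi Xs, g x * c := by
          refine norm_integral_le_of_norm_le (gint.mul_const c) ?_
          filter_upwards [ae_restrict_mem hXm] with x hx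
          rw [Real.norm_eq_abs, abs_mul, abs_of_pos (gpos x hx)]
          exact mul_le_mul_of_nonneg_left (hDb x) (gpos x hx).le
      _ = c := by rw [integral_mul_const, gone, one_mul]
  · rw [integral_undef hB, integral_undef, sub_zero, abs_zero]
    · exact c0
    · intro hc
      apply hB
      refine (hc.sub hgD).congr (Eventually.of_forall fun x => ?_)
      simp

/-- Lipschitz-type control of the smoothed loss in the proportions,
uniformly over `ψ ∈ Ψ_K(X)` and over `h > 0`. -/
theorem statement10
    (J K : ℕ) (hK : 1 ≤ K)
    (Xs : Fin J → Set ℝ) (hXc : ∀ j, IsCompact (Xs j))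
    (C1 C2 C3 : ℝ) (hC1 : 0 < C1) (hC2 : 0 < C2) (hC3 : 0 < C3)
    (Kker : ℝ → ℝ)
    (hK0 : ∀ u, 0 ≤ Kker u)
    (hK1 : (∫ u, Kker u) = 1)
    (hKsym : ∀ u, Kker (-u) = Kker u)
    (hKcont : Continuous Kker)
    (hKL2 : Integrable fun u => (Kker u) ^ 2)
    (hKm1 : (∫ u, u * Kker u) = 0)
    (hKm2 : (∫ u, u ^ 2 * Kker u) ≠ 0)
    (πstar : Fin K → ℝ) (ψstar : Fin K → Fin J → ℝ → ℝ)
    (hstar : memTheta C1 C2 C3 Xs πstar ψstar)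
    (hπpos : ∀ k, 0 < πstar k) :
    (∀ π : Fin K → ℝ, memSimplex π →
      (∀ k, |π k - πstar k| ≤ (⨅ k, πstar k) / (2 * K)) →
      ∀ h : ℝ, 0 < h → ∀ ψ, memPsiK C1 C2 C3 Xs ψ →
        |Lh Kker h Xs (mix πstar ψstar) πstar ψ -
          Lh Kker h Xs (mix πstar ψstar) π ψ| ≤
        2 * ∑ k, |π k - πstar k| / πstar k) ∧
    (∃ C > (0:ℝ), ∀ π : Fin K → ℝ, memSimplex π →
      (∀ k, |π k - πstar k| ≤ (⨅ k, πstar k) / (2 * K)) →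
      ∀ h : ℝ, 0 < h → ∀ ψ, memPsiK C1 C2 C3 Xs ψ →
        |Lh Kker h Xs (mix πstar ψstar) πstar ψ -
          Lh Kker h Xs (mix πstar ψstar) π ψ| ≤
        C * ∑ k, |π k - πstar k|) := by
  have key := fun π hclose h ψ hψ => aux_main J K hK Xs hXc C1 C2 C3 Kker hKcont πstar ψstar
    hstar hπpos π hclose h ψ hψ
  have hne : Nonempty (Fin K) := ⟨⟨0, hK⟩⟩
  refine ⟨fun π _ hclose h _ ψ hψ => key π hclose h ψ hψ,
    2 * ∑ k, 1 / πstar k, ?_, fun π _ hclose h _ ψ hψ => (key π hclose h ψ hψ).trans ?_⟩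
  · have : 0 < ∑ k, 1 / πstar k :=
      Finset.sum_pos (fun k _ => one_div_pos.mpr (hπpos k)) Finset.univ_nonempty
    linarith
  · rw [mul_assoc, Finset.mul_sum Finset.univ (fun k => |π k - πstar k|)]
    refine mul_le_mul_of_nonneg_left (Finset.sum_le_sum fun k _ => ?_) (by norm_num)
    rw [div_eq_mul_one_div, mul_comm]
    refine mul_le_mul_of_nonneg_right ?_ (abs_nonneg _)
    exact Finset.single_le_sum (f := fun k => 1 / πstar k)
      (fun i _ => (one_div_pos.mpr (hπpos i)).le) (Finset.mem_univ k)
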